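/- arXiv:1308.1499 — 6 statements merged into one kernel-verified Lean document; each statement's English description precedes it below -/
import Mathlib

section
/- Let G be a discrete group, A a subset of G and p ∈ G* a free ultrafilter. Then for every finite subset F of G, the p-companion of FA equals F·ϑ_p(A), i.e. ϑ_p(FA) = {f·q : f ∈ F, q ∈ ϑ_p(A)}. -/
open Pointwise

/-- The extension of the group multiplication to `βG`, the space of ultrafilters on `G`:
`A ∈ uMul p q ↔ {g : g⁻¹A ∈ q} ∈ p`. -/
def uMul {G : Type*} [Group G] (p q : Ultrafilter G) : Ultrafilter G :=
  p.bind fun g => q.map (g * ·)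

/-- An ultrafilter is free if it is not principal. -/
def uFree {G : Type*} (p : Ultrafilter G) : Prop := ∀ g : G, p ≠ pure g

/-- `A* = Ā ∩ G*`, the set of free ultrafilters containing `A`. -/
def uStar {G : Type*} (A : Set G) : Set (Ultrafilter G) := {p | A ∈ p ∧ uFree p}

/-- `Gp = {gp : g ∈ G}`. -/
def uOrbit {G : Type*} [Group G] (p : Ultrafilter G) : Set (Ultrafilter G) :=
  {q | ∃ g : G, q = uMul (pure g) p}

/-- The `p`-companion of `A`: `ϑ_p(A) = A* ∩ Gp`. -/
def uCompanion {G : Type*} [Group G] (A : Set G) (p : Ultrafilter G) : Set (Ultrafilter G) :=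
  uStar A ∩ uOrbit p

/-- A set is sparse if all its ultracompanions are finite. -/
def uSparse {G : Type*} [Group G] (A : Set G) : Prop :=
  ∀ p : Ultrafilter G, uFree p → (uCompanion A p).Finite

/-- A set is disparse if all its ultracompanions are discrete subspaces of `βG`. -/
def uDisparse {G : Type*} [Group G] (A : Set G) : Prop :=
  ∀ p : Ultrafilter G, uFree p → DiscreteTopology (uCompanion A p)

/-- `A` is large if `G = FA` for some finite `F`. -/
def uLarge {G : Type*} [Group G] (A : Set G) : Prop :=
  ∃ F : Set G, F.Finite ∧ (Set.univ : Set G) = F * A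

/-- `A` is thick if every finite set has a right translate inside `A` with translating
element from `A`. -/
def uThick {G : Type*} [Group G] (A : Set G) : Prop :=
  ∀ F : Set G, F.Finite → ∃ a ∈ A, (· * a) '' F ⊆ A

/-- `A` is prethick if `FA` is thick for some finite `F`. -/
def uPrethick {G : Type*} [Group G] (A : Set G) : Prop :=
  ∃ F : Set G, F.Finite ∧ uThick (F * A)

/-- `A` is small if `L \ A` is large for every large `L`. -/
def uSmall {G : Type*} [Group G] (A : Set G) : Prop :=
  ∀ L : Set G, uLarge L → uLarge (L \ A)

/-- `A` is thin if `gA ∩ A` is finite for all `g ≠ e`. -/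
def uThin {G : Type*} [Group G] (A : Set G) : Prop :=
  ∀ g : G, g ≠ 1 → (g • A ∩ A).Finite

/-- `FP(a_n) = {a_{i₁} ⋯ a_{i_n} : i₁ < ⋯ < i_n}`. -/
def uFP {G : Type*} [Group G] (a : ℕ → G) : Set G :=
  {g | ∃ l : List ℕ, l ≠ [] ∧ l.Pairwise (· < ·) ∧ g = (l.map a).prod}

theorem mem_uMul_pure {G : Type*} [Group G] (g : G) (q : Ultrafilter G) (A : Set G) :
    A ∈ uMul (pure g) q ↔ (g * ·) ⁻¹' A ∈ q := Iff.rfl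

theorem uMul_pure_mul {G : Type*} [Group G] (g h : G) (q : Ultrafilter G) :
    uMul (pure g) (uMul (pure h) q) = uMul (pure (g * h)) q := by
  ext A
  simp only [mem_uMul_pure, Set.preimage_preimage, mul_assoc]

theorem uMul_pure_one {G : Type*} [Group G] (q : Ultrafilter G) :
    uMul (pure 1) q = q := by
  ext A
  simp only [mem_uMul_pure, one_mul, Set.preimage_id']

theorem uFree_uMul {G : Type*} [Group G] (g : G) (q : Ultrafilter G) (hq : uFree q) :
    uFree (uMul (pure g) q) := by
  intro x hx
  apply hq (g⁻¹ * x)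
  rw [← uMul_pure_one q, ← inv_mul_cancel g, ← uMul_pure_mul, hx]
  ext A
  rfl

/-- Proposition 1(i): `ϑ_p(FA) = F·ϑ_p(A)` for every finite `F ⊆ G`. -/
theorem statement0 {G : Type*} [Group G] (A : Set G) (p : Ultrafilter G) (hp : uFree p)
    (F : Set G) (hF : F.Finite) :
    uCompanion (F * A) p
      = {r : Ultrafilter G | ∃ f ∈ F, ∃ q ∈ uCompanion A p, r = uMul (pure f) q} := by
  ext r
  constructor
  · rintro ⟨⟨hA, hfree⟩, g, hg⟩
    have h : (⋃ f ∈ F, (f * ·) '' A) ∈ r := by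
      rwa [Set.iUnion_mul_left_image]
    rw [Ultrafilter.finite_biUnion_mem_iff hF] at h
    obtain ⟨f, hf, h⟩ := h
    refine ⟨f, hf, uMul (pure f⁻¹) r, ⟨⟨?_, uFree_uMul _ _ hfree⟩, f⁻¹ * g, ?_⟩, ?_⟩
    · rw [mem_uMul_pure]
      simpa [Set.image_mul_left] using h
    · rw [hg, uMul_pure_mul]
    · rw [uMul_pure_mul, mul_inv_cancel, uMul_pure_one]
  · rintro ⟨f, hf, q, ⟨⟨hA, hfree⟩, g, hg⟩, rfl⟩
    refine ⟨⟨?_, uFree_uMul _ _ hfree⟩, f * g, ?_⟩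
    · rw [mem_uMul_pure]
      exact Filter.mem_of_superset hA fun a ha => Set.mul_mem_mul hf ha
    · rw [hg, uMul_pure_mul]
end

section
/- Let G be a discrete group and A an infinite subset of G. The following are equivalent: (i) A is large; (ii) there exists a finite subset F of G such that for every p ∈ G* one has Gp = ϑ_p(FA); (iii) for every p ∈ G* there exists a finite subset F_p of G such that Gp = ϑ_p(F_pA). -/
open Pointwise

theorem aux_free {G : Type*} [Group G] (p : Ultrafilter G) (hp : uFree p) (g : G) :
    uFree (uMul (pure g) p) := by
  intro h e
  apply hp (g⁻¹ * h)
  have h1 : ({h} : Set G) ∈ uMul (pure g) p := by rw [e]; exact Set.mem_singleton h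
  have h2 : (fun x => g * x) ⁻¹' {h} ∈ p := h1
  have h3 : ({g⁻¹ * h} : Set G) ∈ p := by
    filter_upwards [h2] with x hx
    have hx' : g * x = h := hx
    simp [← hx']
  exact Ultrafilter.eq_of_le (by simpa using h3)

theorem aux_one {G : Type*} [Group G] (p : Ultrafilter G) : p ∈ uOrbit p := by
  refine ⟨1, ?_⟩
  ext s
  have : s ∈ uMul (pure 1) p ↔ (fun x => (1 : G) * x) ⁻¹' s ∈ p := Iff.rfl
  rw [this]; simp

theorem aux_i_ii {G : Type*} [Group G] (A : Set G) (h : uLarge A) :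
    ∃ F : Set G, F.Finite ∧
        ∀ p : Ultrafilter G, uFree p → uOrbit p = uCompanion (F * A) p := by
  obtain ⟨F, hF, e⟩ := h
  refine ⟨F, hF, fun p hp => ?_⟩
  rw [← e]
  apply Set.Subset.antisymm
  · rintro q ⟨g, rfl⟩
    exact ⟨⟨Filter.univ_mem, aux_free p hp g⟩, g, rfl⟩
  · exact Set.inter_subset_right

theorem aux_iii_i {G : Type*} [Group G] (A : Set G) (hA : A.Infinite)
    (h : ∀ p : Ultrafilter G, uFree p →
        ∃ F : Set G, F.Finite ∧ uOrbit p = uCompanion (F * A) p) : uLarge A := by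
  by_contra hL
  let f : Filter G := Filter.comk (fun t => ∃ F : Set G, F.Finite ∧ t ⊆ F * A)
    ⟨∅, Set.finite_empty, Set.empty_subset _⟩
    (fun t ⟨F, hF, ht⟩ s hs => ⟨F, hF, hs.trans ht⟩)
    (fun s ⟨F, hF, hs⟩ t ⟨F', hF', ht⟩ => ⟨F ∪ F', hF.union hF', by
      rw [Set.union_mul]; exact Set.union_subset_union hs ht⟩)
  have hmem : ∀ t : Set G, (∃ F : Set G, F.Finite ∧ t ⊆ F * A) → tᶜ ∈ f := by
    intro t ht
    exact Filter.mem_comk.2 (by rwa [compl_compl])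
  have : f.NeBot := by
    refine ⟨fun hbot => ?_⟩
    suffices h0 : ∅ ∈ f → False from h0 (hbot ▸ Filter.mem_bot)
    intro h0
    obtain ⟨F, hF, hs⟩ := Filter.mem_comk.1 h0
    rw [Set.compl_empty] at hs
    exact hL ⟨F, hF, (Set.univ_subset_iff.1 hs).symm⟩
  obtain ⟨a, ha⟩ := hA.nonempty
  have hle := Ultrafilter.of_le f
  have hfree : uFree (Ultrafilter.of f) := by
    intro g e
    have h1 : ({g} : Set G)ᶜ ∈ Ultrafilter.of f := hle (hmem _ ⟨{g * a⁻¹}, Set.finite_singleton _, by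
      rintro x rfl
      exact ⟨x * a⁻¹, rfl, a, ha, by simp⟩⟩)
    rw [e] at h1
    exact h1 rfl
  obtain ⟨F, hF, e⟩ := h _ hfree
  have h1 := aux_one (Ultrafilter.of f)
  rw [e] at h1
  have h2 : (F * A)ᶜ ∈ Ultrafilter.of f := hle (hmem _ ⟨F, hF, subset_rfl⟩)
  exact Ultrafilter.compl_mem_iff_notMem.1 h2 h1.1.1

/-- Proposition 2: characterization of large sets via ultracompanions. -/
theorem statement3 {G : Type*} [Group G] (A : Set G) (hA : A.Infinite) :
    (uLarge A ↔ ∃ F : Set G, F.Finite ∧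
        ∀ p : Ultrafilter G, uFree p → uOrbit p = uCompanion (F * A) p)
    ∧ (uLarge A ↔ ∀ p : Ultrafilter G, uFree p →
        ∃ F : Set G, F.Finite ∧ uOrbit p = uCompanion (F * A) p) := by
  refine ⟨⟨aux_i_ii A, fun ⟨F, hF, h⟩ => aux_iii_i A hA fun p hp => ⟨F, hF, h p hp⟩⟩,
    ⟨fun hl => ?_, aux_iii_i A hA⟩⟩
  obtain ⟨F, hF, h⟩ := aux_i_ii A hl
  exact fun p hp => ⟨F, hF, h p hp⟩
end

section
/- Let G be a discrete group and A an infinite subset of G. Then A is thick if and only if there exists a free ultrafilter p ∈ G* such that ϑ_p(A) = Gp. -/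
open Pointwise

theorem aux_mul {G : Type*} [Group G] (g : G) (p : Ultrafilter G) (A : Set G) :
    A ∈ uMul (pure g) p ↔ {x | g * x ∈ A} ∈ p := by
  have h : uMul (pure g) p = p.map (g * ·) := by
    apply Ultrafilter.coe_injective
    exact Filter.pure_bind g (fun g => ((p.map (g * ·) : Ultrafilter G) : Filter G))
  rw [h]
  rfl

theorem aux_free_s4 {G : Type*} (p : Ultrafilter G) : uFree p ↔ ∀ g : G, {g} ∉ p := by
  refine forall_congr' fun g => not_congr ⟨?_, fun h => ?_⟩
  · rintro rfl
    exact Set.mem_singleton g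
  · apply Ultrafilter.eq_of_le
    exact Filter.le_pure_iff.2 h

theorem aux_pick {G : Type*} [Group G] (A : Set G) (hA : A.Infinite) (hT : uThick A)
    (F : Finset G) : ∃ x : G, x ∉ F ∧ ∀ g ∈ F, g * x ∈ A := by
  classical
  have : Infinite G := Set.infinite_univ_iff.1 (hA.mono (Set.subset_univ A))
  obtain ⟨H, hH⟩ := Infinite.exists_subset_card_eq G (F.card + 1)
  obtain ⟨a, -, ha⟩ := hT ((F * H : Finset G) : Set G) (Finset.finite_toSet _)
  have hc : F.card < (H.image (· * a)).card := by
    rw [Finset.card_image_of_injective _ (mul_left_injective a)]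
    omega
  obtain ⟨x, hx, hxF⟩ := Finset.exists_mem_notMem_of_card_lt_card hc
  obtain ⟨b, hb, rfl⟩ := Finset.mem_image.1 hx
  refine ⟨_, hxF, fun g hg => ?_⟩
  have := ha ⟨g * b, Finset.mem_coe.2 (Finset.mul_mem_mul hg hb), rfl⟩
  simpa [mul_assoc] using this

/-- Proposition 3(i): `A` is thick iff `ϑ_p(A) = Gp` for some `p ∈ G*`. -/
theorem statement4 {G : Type*} [Group G] (A : Set G) (hA : A.Infinite) :
    uThick A ↔ ∃ p : Ultrafilter G, uFree p ∧ uCompanion A p = uOrbit p := by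
  constructor
  · intro hT
    choose x hxF hx using aux_pick A hA hT
    let p : Ultrafilter G := (Ultrafilter.of Filter.atTop).map x
    have key : ∀ s : Set G, (∀ᶠ F in Filter.atTop, x F ∈ s) → s ∈ p :=
      fun s hs => Ultrafilter.of_le Filter.atTop hs
    have hev : ∀ g : G, ∀ᶠ F : Finset G in Filter.atTop, g ∈ F := fun g =>
      (Filter.eventually_ge_atTop {g}).mono fun F hF => hF (Finset.mem_singleton_self g)
    have hfree : ∀ g : G, {g} ∉ p := fun g =>
      Ultrafilter.compl_mem_iff_notMem.1 (key _ ((hev g).mono fun F hF h => by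
        have h' : x F = g := h
        exact hxF F (h' ▸ hF)))
    refine ⟨p, (aux_free_s4 p).2 hfree, Set.inter_eq_right.2 ?_⟩
    rintro q ⟨g, rfl⟩
    refine ⟨(aux_mul g p A).2 (key _ ((hev g).mono fun F hF => hx F g hF)),
      (aux_free_s4 _).2 fun h hh => hfree (g⁻¹ * h) ?_⟩
    rw [aux_mul] at hh
    refine Filter.mem_of_superset hh fun y hy => ?_
    have hy' : g * y = h := hy
    simp [← hy']
  · rintro ⟨p, -, hp⟩ F hF
    have hm : ∀ g : G, {x | g * x ∈ A} ∈ p := fun g =>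
      (aux_mul g p A).1 ((Set.inter_eq_right.1 hp) ⟨g, rfl⟩).1
    have hI : (⋂ g ∈ F, {x | g * x ∈ A}) ∈ (p : Filter G) :=
      (Filter.biInter_mem hF).2 fun g _ => hm g
    obtain ⟨a, ha1, ha⟩ := p.nonempty_of_mem (Filter.inter_mem (hm 1) hI)
    refine ⟨a, by simpa using ha1, ?_⟩
    rintro _ ⟨g, hg, rfl⟩
    exact Set.mem_iInter₂.1 ha g hg
end

section
/- Let G be a discrete group and A a subset of G. Then A is sparse if and only if every free ultrafilter p with A ∈ p is strongly prime, i.e. every p ∈ A* lies outside the closure of G*G* in βG. -/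
open Pointwise

theorem aux_coloring {G : Type*} [Group G] (g : G) (hg : g ≠ 1) :
    ∃ m : ℕ, m ≠ 0 ∧ m ≠ 1 ∧ ∃ f : G → ZMod m, ∀ x, f (g * x) = f x + 1 := by
  have hd : ∃ m : ℕ, m ≠ 0 ∧ m ≠ 1 ∧ (m : ℤ) ∣ (orderOf g : ℤ) := by
    by_cases h : orderOf g = 0
    · exact ⟨2, by norm_num, by norm_num, by simp [h]⟩
    · exact ⟨orderOf g, h, by simpa [orderOf_eq_one_iff] using hg, dvd_rfl⟩
  obtain ⟨m, h0, h1, hm⟩ := hd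
  refine ⟨m, h0, h1, ?_⟩
  let s : Setoid G := MulAction.orbitRel (Subgroup.zpowers g) G
  have ht : ∀ x : G, ∃ k : ℤ, x = g ^ k * (Quotient.mk s x).out := by
    intro x
    have h : s x (Quotient.mk s x).out := Setoid.symm (Quotient.mk_out x)
    obtain ⟨⟨_, k, rfl⟩, hk⟩ := h
    exact ⟨k, hk.symm⟩
  choose k hk using ht
  refine ⟨fun x => (k x : ZMod m), fun x => ?_⟩
  have hq : Quotient.mk s (g * x) = Quotient.mk s x :=
    Quotient.sound ⟨⟨g, Subgroup.mem_zpowers g⟩, rfl⟩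
  have e : g ^ (k (g * x)) = g ^ (k x + 1) := by
    have a := hk (g * x)
    have b : g * x = g * (g ^ k x * (Quotient.mk s x).out) := congrArg (g * ·) (hk x)
    rw [hq] at a
    rw [a, ← mul_assoc] at b
    rw [mul_right_cancel b, add_comm, zpow_add, zpow_one]
  have e2 := (zpow_eq_zpow_iff_modEq.1 e).of_dvd hm
  have := (ZMod.intCast_eq_intCast_iff _ _ m).2 e2
  simpa using this

theorem aux_fixed {G : Type*} [Group G] (g : G) (r : Ultrafilter G)
    (h : r.map (g * ·) = r) : g = 1 := by
  by_contra hg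
  obtain ⟨m, h0, h1, f, hf⟩ := aux_coloring g hg
  have : NeZero m := ⟨h0⟩
  have : Fact (1 < m) := ⟨by omega⟩
  obtain ⟨c, -, hc⟩ := Ultrafilter.eq_pure_of_finite_mem (f := r.map f) Set.finite_univ
    Filter.univ_mem
  have hc1 : f ⁻¹' {c} ∈ r := by
    have : ({c} : Set (ZMod m)) ∈ r.map f := by rw [hc]; exact Set.mem_singleton c
    exact this
  have hc2 : (g * ·) ⁻¹' (f ⁻¹' {c}) ∈ r := by
    have h2 := hc1
    rw [← h] at h2
    exact h2
  obtain ⟨x, hx1, hx2⟩ := r.nonempty_of_mem (Filter.inter_mem hc1 hc2)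
  have a : f x = c := hx1
  have b : f (g * x) = c := hx2
  rw [hf, a] at b
  exact one_ne_zero (add_eq_left.1 b)

theorem aux_pure_mul {G : Type*} [Group G] (g : G) (r : Ultrafilter G) :
    uMul (pure g) r = r.map (g * ·) := by
  ext s
  exact Iff.rfl

theorem aux_mem_mul {G : Type*} [Group G] (q r : Ultrafilter G) (A : Set G) :
    A ∈ uMul q r ↔ {g | A ∈ r.map (g * ·)} ∈ q := Iff.rfl

theorem aux_inj {G : Type*} [Group G] (r : Ultrafilter G) :
    Function.Injective fun g : G => r.map (g * ·) := by
  intro a b hab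
  have h : (r.map (a * ·)).map (b⁻¹ * ·) = (r.map (b * ·)).map (b⁻¹ * ·) :=
    congrArg (Ultrafilter.map (b⁻¹ * ·)) hab
  rw [Ultrafilter.map_map, Ultrafilter.map_map] at h
  have e1 : ((b⁻¹ * ·) ∘ (a * ·) : G → G) = ((b⁻¹ * a) * ·) := by
    funext x; simp [mul_assoc]
  have e2 : ((b⁻¹ * ·) ∘ (b * ·) : G → G) = id := by
    funext x; simp
  rw [e1, e2, Ultrafilter.map_id] at h
  exact (inv_mul_eq_one.1 (aux_fixed _ r h)).symm

theorem aux_free_map {G : Type*} [Group G] (g : G) (r : Ultrafilter G) (hr : uFree r) :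
    uFree (r.map (g * ·)) := by
  intro x hx
  have h : ({x} : Set G) ∈ r.map (g * ·) := by rw [hx]; exact Set.mem_singleton x
  have h2 : ({g⁻¹ * x} : Set G) ∈ r := by
    refine Filter.mem_of_superset (show (g * ·) ⁻¹' {x} ∈ r from h) ?_
    intro y hy
    have : g * y = x := hy
    simp [← this]
  obtain ⟨y, -, hy⟩ := Ultrafilter.eq_pure_of_finite_mem (Set.finite_singleton _) h2
  exact hr y hy

theorem aux_free_mul {G : Type*} [Group G] (q r : Ultrafilter G) (hr : uFree r) :
    uFree (uMul q r) := by
  intro x hx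
  have h : ({x} : Set G) ∈ uMul q r := by rw [hx]; exact Set.mem_singleton x
  rw [aux_mem_mul] at h
  obtain ⟨g, hg⟩ := q.nonempty_of_mem h
  replace hg : ({x} : Set G) ∈ r.map (g * ·) := hg
  obtain ⟨y, -, hy⟩ := Ultrafilter.eq_pure_of_finite_mem (Set.finite_singleton _) hg
  exact aux_free_map g r hr y hy

theorem aux_exists_free {G : Type*} (S : Set G) (hS : S.Infinite) :
    ∃ q : Ultrafilter G, uFree q ∧ S ∈ q := by
  have : (Filter.cofinite ⊓ Filter.principal S).NeBot := hS.cofinite_inf_principal_neBot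
  refine ⟨Ultrafilter.of (Filter.cofinite ⊓ Filter.principal S), ?_, ?_⟩
  · intro x hx
    have h : ({x}ᶜ : Set G) ∈ Ultrafilter.of (Filter.cofinite ⊓ Filter.principal S) :=
      Ultrafilter.of_le _ (Filter.mem_inf_of_left (Set.finite_singleton x).compl_mem_cofinite)
    rw [hx] at h
    exact h rfl
  · exact Ultrafilter.of_le _ (Filter.mem_inf_of_right (Filter.mem_principal_self S))

theorem aux_companion {G : Type*} [Group G] (A : Set G) (r : Ultrafilter G) (hr : uFree r) :
    uCompanion A r = (fun g : G => r.map (g * ·)) '' {g | A ∈ r.map (g * ·)} := by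
  ext x
  constructor
  · rintro ⟨⟨hA, -⟩, g, rfl⟩
    rw [aux_pure_mul] at *
    exact ⟨g, hA, rfl⟩
  · rintro ⟨g, hA, rfl⟩
    exact ⟨⟨hA, aux_free_map g r hr⟩, g, (aux_pure_mul g r).symm⟩

/-- Proposition 5, (i) ⇔ (ii): `A` is sparse iff every `p ∈ A*` is strongly prime,
i.e. lies outside the closure of `G*G*` in `βG`. -/
theorem statement9 {G : Type*} [Group G] (A : Set G) :
    uSparse A ↔ ∀ p : Ultrafilter G, p ∈ uStar A →
      p ∉ closure {x : Ultrafilter G |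
        ∃ q r : Ultrafilter G, uFree q ∧ uFree r ∧ x = uMul q r} := by
  constructor
  · intro hA p hp hcl
    obtain ⟨x, hxA, q, r, hq, hr, rfl⟩ :=
      mem_closure_iff.1 hcl {u | A ∈ u} (ultrafilter_isOpen_basic A) hp.1
    have hfin := hA r hr
    rw [aux_companion A r hr] at hfin
    have hfin2 := hfin.of_finite_image (aux_inj r).injOn
    obtain ⟨y, -, hy⟩ := Ultrafilter.eq_pure_of_finite_mem hfin2 hxA
    exact hq y hy
  · intro H r hr
    rw [aux_companion A r hr]
    apply Set.Finite.image
    by_contra hinf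
    obtain ⟨q, hq, hS⟩ := aux_exists_free _ hinf
    exact H (uMul q r) ⟨hS, aux_free_mul q r hr⟩ (subset_closure ⟨q, r, hq, hr, rfl⟩)
end

section
/- Let G be a discrete group. The family Sp_G of all sparse subsets of G is a left and right translation invariant ideal in the Boolean algebra of all subsets of G: if A and B are sparse then A ∪ B is sparse; any subset of a sparse set is sparse; and for every sparse A and g ∈ G, both gA and Ag are sparse. -/
open Pointwise

theorem uMul_pure_aux {G : Type*} [Group G] (g : G) (p : Ultrafilter G) :
    uMul (pure g) p = p.map (g * ·) := by
  ext s
  rfl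

theorem uFree_map_aux {G : Type*} (e : G ≃ G) (p : Ultrafilter G) (hp : uFree p) :
    uFree (p.map e) := by
  intro g h
  apply hp (e.symm g)
  have h2 := congrArg (Ultrafilter.map e.symm) h
  rw [Ultrafilter.map_map, Ultrafilter.map_pure] at h2
  simpa using h2

theorem umap_inj_aux {G : Type*} (e : G ≃ G) :
    Function.Injective (fun p : Ultrafilter G => p.map e) := by
  intro p q h
  have h2 := congrArg (Ultrafilter.map e.symm) h
  simpa [Ultrafilter.map_map] using h2

/-- Proposition 7: the sparse subsets form a left and right translation invariant ideal. -/
theorem statement12 {G : Type*} [Group G] :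
    (∀ A B : Set G, uSparse A → uSparse B → uSparse (A ∪ B))
    ∧ (∀ A A' : Set G, uSparse A → A' ⊆ A → uSparse A')
    ∧ (∀ A : Set G, uSparse A → ∀ g : G, uSparse (g • A) ∧ uSparse ((· * g) '' A)) := by
  refine ⟨?_, ?_, ?_⟩
  · intro A B hA hB p hp
    refine ((hA p hp).union (hB p hp)).subset ?_
    rintro q ⟨⟨hq, hf⟩, ho⟩
    rcases Ultrafilter.union_mem_iff.1 hq with h | h
    · exact Or.inl ⟨⟨h, hf⟩, ho⟩
    · exact Or.inr ⟨⟨h, hf⟩, ho⟩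
  · intro A A' hA hs p hp
    refine (hA p hp).subset ?_
    rintro q ⟨⟨hq, hf⟩, ho⟩
    exact ⟨⟨Filter.mem_of_superset hq hs, hf⟩, ho⟩
  · intro A hA g
    constructor
    · intro p hp
      refine ((hA p hp).preimage (umap_inj_aux (Equiv.mulLeft g⁻¹)).injOn).subset ?_
      rintro q ⟨⟨hq, hf⟩, ⟨h, ho⟩⟩
      refine ⟨⟨?_, uFree_map_aux _ _ hf⟩, ⟨g⁻¹ * h, ?_⟩⟩
      · rw [Ultrafilter.mem_map]
        refine Filter.mem_of_superset hq ?_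
        rintro _ ⟨a, ha, rfl⟩
        simpa using ha
      · rw [uMul_pure_aux] at ho ⊢
        subst ho
        simp only [Ultrafilter.map_map]
        congr 1
        ext x
        simp [mul_assoc]
    · intro p hp
      refine ((hA _ (uFree_map_aux (Equiv.mulRight g⁻¹) p hp)).preimage
        (umap_inj_aux (Equiv.mulRight g⁻¹)).injOn).subset ?_
      rintro q ⟨⟨hq, hf⟩, ⟨h, ho⟩⟩
      refine ⟨⟨?_, uFree_map_aux _ _ hf⟩, ⟨h, ?_⟩⟩
      · rw [Ultrafilter.mem_map]
        refine Filter.mem_of_superset hq ?_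
        rintro _ ⟨a, ha, rfl⟩
        simpa using ha
      · rw [uMul_pure_aux] at ho ⊢
        subst ho
        simp only [Ultrafilter.map_map]
        congr 1
        ext x
        simp [mul_assoc]
end

section
/- Let G be an infinite discrete group. Then every sparse subset of G is disparse, every disparse subset of G is small, and both inclusions are strict: there exists a disparse subset of G that is not sparse, and there exists a small subset of G that is not disparse. -/
open Pointwise

open Filter Topology

section helpers

variable {G : Type*} [Group G]

theorem mem_tr {g : G} {p : Ultrafilter G} {A : Set G} :
    A ∈ uMul (pure g) p ↔ {x | g * x ∈ A} ∈ p := by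
  rfl

theorem tr_tr (g h : G) (p : Ultrafilter G) :
    uMul (pure g) (uMul (pure h) p) = uMul (pure (g * h)) p := by
  ext A
  simp only [mem_tr, Set.mem_setOf_eq, mul_assoc]

theorem tr_one (p : Ultrafilter G) : uMul (pure 1) p = p := by
  ext A
  simp only [mem_tr, one_mul, Set.setOf_mem_eq]

theorem uFree_iff {α : Type*} {p : Ultrafilter α} : uFree p ↔ ∀ g, {x | x ≠ g} ∈ p := by
  unfold uFree
  refine forall_congr' fun g => ?_
  have : {x | x ≠ g} = ({g} : Set α)ᶜ := rfl
  rw [this, Ultrafilter.compl_mem_iff_notMem, not_iff_not]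
  constructor
  · rintro rfl
    exact Ultrafilter.mem_pure.2 rfl
  · intro h
    obtain ⟨x, hx, h2⟩ := Ultrafilter.eq_pure_of_finite_mem (Set.finite_singleton g) h
    rw [h2]; rw [hx]

theorem uFree.finite_notMem {α : Type*} {p : Ultrafilter α} (hp : uFree p) {S : Set α}
    (hS : S.Finite) : S ∉ p := by
  intro h
  obtain ⟨x, hx, h2⟩ := Ultrafilter.eq_pure_of_finite_mem hS h
  exact hp x h2

theorem uFree.tr {p : Ultrafilter G} (hp : uFree p) (g : G) : uFree (uMul (pure g) p) := by
  rw [uFree_iff] at *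
  intro h
  rw [mem_tr]
  refine Filter.mem_of_superset (hp (g⁻¹ * h)) ?_
  intro x hx hh
  apply hx
  have hh : g * x = h := hh
  rw [← hh]; group

theorem continuous_tr (g : G) : Continuous (fun p : Ultrafilter G => uMul (pure g) p) := by
  refine ultrafilterBasis_is_basis.continuous_iff.2 <| Set.forall_mem_range.mpr fun s => ?_
  exact ultrafilter_isOpen_basic {x : G | g * x ∈ s}

theorem tr_ne {g : G} (hg : g ≠ 1) (p : Ultrafilter G) : uMul (pure g) p ≠ p := by
  intro h
  obtain ⟨S, hS⟩ : ∃ S : Set G, Maximal (fun S : Set G => ∀ x ∈ S, g * x ∉ S) S := by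
    refine zorn_subset {S : Set G | ∀ x ∈ S, g * x ∉ S} ?_
    intro c hc hch
    refine ⟨⋃₀ c, ?_, fun s hs => Set.subset_sUnion_of_mem hs⟩
    rintro x ⟨s, hs, hx⟩ ⟨t, ht, hx'⟩
    rcases hch.total hs ht with h1 | h1
    · exact hc ht x (h1 hx) hx'
    · exact hc hs x hx (h1 hx')
  have hne : ∀ x, g * x ≠ x := fun x hx => hg (mul_eq_right.1 hx)
  have cov : ∀ x, x ∈ S ∨ g * x ∈ S ∨ g⁻¹ * x ∈ S := by
    intro x
    by_contra! hx
    obtain ⟨h1, h2, h3⟩ := hx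
    have : insert x S ⊆ S := by
      refine hS.2 ?_ (Set.subset_insert x S)
      intro y hy hy'
      rcases hy with rfl | hy <;> rcases hy' with hy' | hy'
      · exact hne _ hy'
      · exact h2 hy'
      · apply h3; rw [← hy']; simpa using hy
      · exact hS.1 y hy hy'
    exact h1 (this (Set.mem_insert x S))
  have key : ∀ A : Set G, A ∈ p ↔ {x | g * x ∈ A} ∈ p := by
    intro A
    conv_lhs => rw [← h]
    exact mem_tr
  have hSp : S ∈ p := by
    have hu : S ∪ ({x | g * x ∈ S} ∪ {x | g⁻¹ * x ∈ S}) ∈ p :=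
      Filter.mem_of_superset Filter.univ_mem (fun x _ => cov x)
    rcases Ultrafilter.union_mem_iff.1 hu with h1 | h1
    · exact h1
    rcases Ultrafilter.union_mem_iff.1 h1 with h1 | h1
    · exact (key S).2 h1
    · have := (key _).1 h1
      simpa using this
  have h2 := (key S).1 hSp
  obtain ⟨x, hx1, hx2⟩ := Ultrafilter.nonempty_of_mem (Filter.inter_mem hSp h2)
  exact hS.1 x hx1 hx2

theorem tr_inj (p : Ultrafilter G) : Function.Injective (fun g : G => uMul (pure g) p) := by
  intro g h hgh
  by_contra hne
  have hgh : uMul (pure g) p = uMul (pure h) p := hgh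
  have := congrArg (uMul (pure h⁻¹)) hgh
  rw [tr_tr, tr_tr, inv_mul_cancel, tr_one] at this
  refine tr_ne ?_ p this
  intro h1
  exact hne (inv_mul_eq_one.1 h1).symm

theorem sparse_disparse (A : Set G) (h : uSparse A) : uDisparse A := by
  intro p hp
  have : Finite (uCompanion A p) := (h p hp).to_subtype
  infer_instance

theorem small_crit (A : Set G)
    (h : ∀ F : Set G, F.Finite → ∃ K : Set G, K.Finite ∧ ∀ x, ∃ k ∈ K, k * x ∉ F * A) :
    uSmall A := by
  rintro L ⟨F, hF, hL⟩
  obtain ⟨K, hK, hx⟩ := h F hF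
  refine ⟨K⁻¹ * F, hK.inv.mul hF, ?_⟩
  symm
  rw [Set.eq_univ_iff_forall]
  intro x
  obtain ⟨k, hk, hkx⟩ := hx x
  have : k * x ∈ F * L := hL ▸ Set.mem_univ _
  obtain ⟨f, hf, l, hl, hfl⟩ := this
  simp only at hfl
  refine ⟨k⁻¹ * f, Set.mul_mem_mul (Set.inv_mem_inv.2 hk) hf, l, ⟨hl, ?_⟩, ?_⟩
  · intro hlA
    exact hkx (hfl ▸ Set.mul_mem_mul hf hlA)
  · simp only [mul_assoc, hfl]; group

theorem disparse_small [Infinite G] (A : Set G) (hA : uDisparse A) : uSmall A := by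
  refine small_crit A ?_
  by_contra! hcon
  obtain ⟨F, hF, hK⟩ := hcon
  -- invariant closed sets
  let I : Set (Ultrafilter G) := {q | uFree q ∧ ∀ g, F * A ∈ uMul (pure g) q}
  have hIc : IsClosed I := by
    have : I = (⋂ g : G, {q | {x | x ≠ g} ∈ q}) ∩ ⋂ g : G, {q | {x | g * x ∈ F * A} ∈ q} := by
      ext q
      simp only [I, uFree_iff, Set.mem_setOf_eq, Set.mem_inter_iff, Set.mem_iInter, mem_tr]
    rw [this]
    exact (isClosed_iInter fun g => ultrafilter_isClosed_basic _).inter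
      (isClosed_iInter fun g => ultrafilter_isClosed_basic _)
  have hIn : I.Nonempty := by
    choose x hx using fun K : Finset G => hK K K.finite_toSet
    let q : Ultrafilter G := (Ultrafilter.of (atTop : Filter (Finset G))).map x
    have hq : ∀ g, F * A ∈ uMul (pure g) q := by
      intro g
      rw [mem_tr]
      change {K | g * x K ∈ F * A} ∈ Ultrafilter.of (atTop : Filter (Finset G))
      apply Ultrafilter.of_le
      filter_upwards [eventually_ge_atTop {g}] with K hKg
      exact hx K g (by simpa using hKg)
    by_cases hfree : uFree q
    · exact ⟨q, hfree, hq⟩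
    · have : ∃ g, q = pure g := by simpa [uFree] using hfree
      obtain ⟨g, hg⟩ := this
      have hall : F * A = Set.univ := by
        rw [Set.eq_univ_iff_forall]
        intro y
        have h1 := hq (y * g⁻¹)
        rw [hg, mem_tr, Ultrafilter.mem_pure] at h1
        simpa using h1
      refine ⟨hyperfilter G, ?_, fun g => ?_⟩
      · rw [uFree_iff]
        intro g
        have : {x | x ≠ g} = ({g} : Set G)ᶜ := rfl
        rw [this]
        exact mem_hyperfilter_of_finite_compl (by simp)
      · rw [hall]; exact Filter.univ_mem
  have hIi : ∀ g, ∀ q ∈ I, uMul (pure g) q ∈ I := by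
    rintro g q ⟨h1, h2⟩
    refine ⟨h1.tr g, fun h => ?_⟩
    rw [tr_tr]
    exact h2 _
  let Z : Set (Set (Ultrafilter G)) :=
    {M | IsClosed M ∧ M.Nonempty ∧ ∀ g, ∀ q ∈ M, uMul (pure g) q ∈ M}
  obtain ⟨M, hMI, hM⟩ : ∃ M, M ⊆ I ∧ Minimal (· ∈ Z) M := by
    refine zorn_superset_nonempty Z ?_ I ⟨hIc, hIn, hIi⟩
    intro c hc hch hcn
    refine ⟨⋂₀ c, ⟨isClosed_sInter fun s hs => (hc hs).1, ?_, ?_⟩,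
      fun s hs => Set.sInter_subset_of_mem hs⟩
    · have : Nonempty c := hcn.to_subtype
      refine IsCompact.nonempty_sInter_of_directed_nonempty_isCompact_isClosed ?_
        (fun s hs => (hc hs).2.1) (fun s hs => (hc hs).1.isCompact) (fun s hs => (hc hs).1)
      intro s hs u hu
      rcases hch.total hs hu with h | h
      · exact ⟨s, hs, subset_rfl, h⟩
      · exact ⟨u, hu, h, subset_rfl⟩
    · intro g q hq s hs
      exact (hc hs).2.2 g q (hq s hs)
  obtain ⟨hMc, ⟨q, hqM⟩, hMi⟩ := hM.1
  have hmin : ∀ r ∈ M, M ⊆ closure (Set.range fun g : G => uMul (pure g) r) := by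
    intro r hr
    refine hM.2 ⟨isClosed_closure, ⟨r, subset_closure ⟨1, tr_one r⟩⟩, ?_⟩ ?_
    · intro g s hs
      refine map_mem_closure (continuous_tr g) hs ?_
      rintro _ ⟨h, rfl⟩
      exact ⟨g * h, (tr_tr g h r).symm⟩
    · refine closure_minimal ?_ hMc
      rintro _ ⟨h, rfl⟩
      exact hMi h r hr
  obtain ⟨p, hpM, hAp⟩ : ∃ p ∈ M, A ∈ p := by
    have h1 := (hMI hqM).2 1
    rw [tr_one] at h1
    rw [← Set.iUnion_mul_left_image] at h1
    obtain ⟨f, hf, h2⟩ := (Ultrafilter.finite_biUnion_mem_iff hF).1 h1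
    refine ⟨uMul (pure f⁻¹) q, hMi _ _ hqM, ?_⟩
    rw [mem_tr]
    refine Filter.mem_of_superset h2 ?_
    rintro _ ⟨a, ha, rfl⟩
    simpa using ha
  have hpf : uFree p := (hMI hpM).1
  obtain ⟨U, hUo, hU⟩ := discreteTopology_subtype_iff'.1 (hA p hpf) p
    ⟨⟨hAp, hpf⟩, 1, (tr_one p).symm⟩
  have hpU : p ∈ U := by
    have : p ∈ U ∩ uCompanion A p := hU ▸ rfl
    exact this.1
  let V := U ∩ {q | A ∈ q}
  have hVo : IsOpen V := hUo.inter (ultrafilter_isOpen_basic A)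
  have hpV : p ∈ V := ⟨hpU, hAp⟩
  have hVorb : ∀ g : G, uMul (pure g) p ∈ V → uMul (pure g) p = p := by
    intro g hg
    have : uMul (pure g) p ∈ U ∩ uCompanion A p := ⟨hg.1, ⟨hg.2, hpf.tr g⟩, g, rfl⟩
    rwa [hU] at this
  have hVM : ∀ r ∈ M, r ∈ V → r = p := by
    intro r hrM hrV
    by_contra hne
    have ho : IsOpen (V ∩ {p}ᶜ) := hVo.inter isOpen_compl_singleton
    obtain ⟨_, h1, g, rfl⟩ := mem_closure_iff.1 (hmin p hpM hrM) _ ho ⟨hrV, hne⟩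
    exact h1.2 (hVorb g h1.1)
  have hcov : M ⊆ ⋃ g : G, {r | uMul (pure g) r ∈ V} := by
    intro r hr
    obtain ⟨_, h1, g, rfl⟩ := mem_closure_iff.1 (hmin r hr hpM) V hVo hpV
    exact Set.mem_iUnion.2 ⟨g, h1⟩
  obtain ⟨K, hKc⟩ := hMc.isCompact.elim_finite_subcover _
    (fun g => hVo.preimage (continuous_tr g)) hcov
  have hMfin : M.Finite := by
    refine Set.Finite.subset (K.finite_toSet.image fun g => uMul (pure g⁻¹) p) ?_
    intro r hr
    obtain ⟨g, hg, h1⟩ := Set.mem_iUnion₂.1 (hKc hr)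
    refine ⟨g, hg, ?_⟩
    have h2 := hVM _ (hMi g r hr) h1
    simp only
    rw [← h2, tr_tr, inv_mul_cancel, tr_one]
  exact Set.infinite_of_injective_forall_mem (tr_inj p) (fun g => hMi g p hpM) hMfin

/-- A step of the exhausting chain. -/
noncomputable def chainStep [Infinite G] (e : G) (F : Finset G) : Finset G := by
  classical
  exact
    let T := insert 1 (insert (Infinite.exists_notMem_finset F).choose (insert e F))
    (T ∪ T⁻¹) * (T ∪ T⁻¹)

noncomputable def chain [Infinite G] (e : ℕ → G) : ℕ → Finset G
  | 0 => ∅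
  | n + 1 => chainStep (e n) (chain e n)

theorem exists_chain [Infinite G] (e : ℕ → G) :
    ∃ (F : ℕ → Set G) (x : ℕ → G), (∀ n, (F n).Finite) ∧ (∀ n, e n ∈ F (n + 1)) ∧
      (∀ n, x n ∉ F n) ∧ (∀ n, x n ∈ F (n + 1)) ∧ Monotone F ∧
      (∀ n, ∀ g ∈ F n, g⁻¹ ∈ F n) ∧
      (∀ n, ∀ g ∈ F n, ∀ h ∈ F n, g * h ∈ F (n + 1)) := by
  classical
  let x : ℕ → G := fun n => (Infinite.exists_notMem_finset (chain e n)).choose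
  let T : ℕ → Finset G := fun n => insert 1 (insert (x n) (insert (e n) (chain e n)))
  let S : ℕ → Finset G := fun n => T n ∪ (T n)⁻¹
  have hc : ∀ n, chain e (n + 1) = S n * S n := by
    intro n
    simp only [chain, chainStep, S, T, x]
  have h1 : ∀ n, (1 : G) ∈ S n := fun n => by simp [S, T]
  have hS : ∀ n, S n ⊆ chain e (n + 1) := by
    intro n g hg
    rw [hc]
    simpa using Finset.mul_mem_mul hg (h1 n)
  have hF : ∀ n, chain e n ⊆ S n := by
    intro n g hg
    simp [S, T, hg]
  refine ⟨fun n => chain e n, x, fun n => Finset.finite_toSet _, fun n => hS n (by simp [S, T]),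
    fun n => (Infinite.exists_notMem_finset (chain e n)).choose_spec,
    fun n => hS n (by simp [S, T]), monotone_nat_of_le_succ fun n g hg => hS n (hF n hg), ?_, ?_⟩
  · intro n g hg
    cases n with
    | zero => simp [chain] at hg
    | succ n =>
      have hSi : (S n)⁻¹ = S n := by
        ext a; simp only [S, Finset.mem_inv', Finset.mem_union, inv_inv]; exact or_comm
      have hg : g ∈ chain e (n + 1) := hg
      show g⁻¹ ∈ chain e (n + 1)
      rw [hc] at *
      rw [← hSi, ← Finset.mem_inv']
      simpa [mul_inv_rev, hSi] using hg
  · intro n g hg h hh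
    show g * h ∈ chain e (n + 1)
    rw [hc]
    exact Finset.mul_mem_mul (hF n hg) (hF n hh)

theorem exists_disparse_not_sparse [Infinite G] : ∃ A : Set G, uDisparse A ∧ ¬uSparse A := by
  obtain ⟨F, x, -, -, hx1, hx2, hmono, hinv, hmul⟩ := exists_chain (fun _ : ℕ => (1 : G))
  have mul' : ∀ {a b c : ℕ} {g h : G}, g ∈ F a → h ∈ F b → a < c → b < c → g * h ∈ F c := by
    intro a b c g h hg hh hac hbc
    have := hmul (c - 1) g (hmono (by omega) hg) h (hmono (by omega) hh)
    rwa [Nat.sub_add_cancel (by omega)] at this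
  let t : ℕ → G := fun n => x (10 * n)
  have ht1 : ∀ n, t n ∉ F (10 * n) := fun n => hx1 _
  have ht2 : ∀ n, t n ∈ F (10 * n + 1) := fun n => hx2 _
  have ht2' : ∀ m n, m < n → t m ∈ F (10 * n - 9) := fun m n h => hmono (by omega) (ht2 m)
  have htinj : Function.Injective t := by
    have : ∀ m n, m < n → t m ≠ t n := fun m n h he =>
      ht1 n (he ▸ hmono (by omega) (ht2 m))
    intro m n he
    rcases lt_trichotomy m n with h | h | h
    · exact (this m n h he).elim
    · exact h
    · exact (this n m h he.symm).elim
  let B : ℕ → Set G := fun i => {g | ∃ j, i < j ∧ g = t i * t j}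
  let A : Set G := ⋃ i, B i
  have mem_some : ∀ h i j k l, h * (t i * t j) = t k * t l → ∃ N, h ∈ F N := by
    intro h i j k l he
    have : h = (t k * t l) * ((t j)⁻¹ * (t i)⁻¹) := by
      rw [← he]; group
    refine ⟨10 * (i + j + k + l) + 5, ?_⟩
    rw [this]
    have m1 : t k * t l ∈ F (10 * (i + j + k + l) + 3) :=
      mul' (ht2 k) (ht2 l) (by omega) (by omega)
    have m2 : (t j)⁻¹ * (t i)⁻¹ ∈ F (10 * (i + j + k + l) + 3) :=
      mul' (hinv _ _ (ht2 j)) (hinv _ _ (ht2 i)) (by omega) (by omega)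
    exact mul' m1 m2 (by omega) (by omega)
  have aux2 : ∀ h N i k, h ∈ F N → h * t i = t k → i < k → k ≤ N := by
    intro h N i k hh he hik
    by_contra! hk
    apply ht1 k
    rw [← he]
    exact mul' hh (ht2 i) (by omega) (by omega)
  have aux4 : ∀ h N i j k l, h ∈ F N → h * (t i * t j) = t k * t l → i < j → k < l → j < l →
      l ≤ N := by
    intro h N i j k l hh he hij hkl hjl
    by_contra! hk
    apply ht1 l
    have : t l = (t k)⁻¹ * (h * (t i * t j)) := by rw [he]; group
    rw [this]
    have m1 : t i * t j ∈ F (10 * l - 8) :=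
      mul' (ht2' i l (by omega)) (ht2' j l hjl) (by omega) (by omega)
    have m2 : h * (t i * t j) ∈ F (10 * l - 7) :=
      mul' hh m1 (by omega) (by omega)
    exact mul' (hinv _ _ (ht2' k l hkl)) m2 (by omega) (by omega)
  have key : ∀ h N i j k l, h ≠ 1 → h ∈ F N → h * (t i * t j) = t k * t l → i < j → k < l →
      i ≤ N ∧ (i = k → j ≤ N) := by
    intro h N i j k l h1 hh he hij hkl
    have hhi := hinv _ _ hh
    have he' : h⁻¹ * (t k * t l) = t i * t j := by rw [← he]; group
    rcases lt_trichotomy j l with hjl | hjl | hjl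
    · have := aux4 h N i j k l hh he hij hkl hjl
      omega
    · subst hjl
      have e1 : h * t i = t k := by rwa [← mul_assoc, mul_left_inj] at he
      have e2 : h⁻¹ * t k = t i := by rw [← e1]; group
      rcases lt_trichotomy i k with hik | hik | hik
      · have := aux2 h N i k hh e1 hik
        omega
      · subst hik
        exact (h1 (mul_eq_right.1 e1)).elim
      · have := aux2 _ N k i hhi e2 hik
        omega
    · have := aux4 _ N k l i j hhi he' hkl hij hjl
      omega
  refine ⟨A, ?_, ?_⟩
  · intro p hp
    rw [discreteTopology_subtype_iff']
    rintro _ ⟨⟨hAq, hqf⟩, g, rfl⟩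
    set q := uMul (pure g) p with hq
    have horb : ∀ r ∈ uOrbit p, ∃ h : G, r = uMul (pure h) q := by
      rintro _ ⟨g', rfl⟩
      exact ⟨g' * g⁻¹, by rw [hq, tr_tr]; simp⟩
    have hqc : q ∈ uCompanion A p := ⟨⟨hAq, hqf⟩, g, rfl⟩
    by_cases hB : ∃ i, B i ∈ q
    · obtain ⟨i, hi⟩ := hB
      refine ⟨{r | B i ∈ r}, ultrafilter_isOpen_basic _, ?_⟩
      refine Set.Subset.antisymm ?_ (Set.singleton_subset_iff.2 ⟨hi, hqc⟩)
      rintro r ⟨hr1, -, hr2⟩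
      obtain ⟨h, rfl⟩ := horb r hr2
      by_cases h1 : h = 1
      · rw [h1, tr_one]; rfl
      exfalso
      have hr1 : {y | h * y ∈ B i} ∈ q := hr1
      have hint := Filter.inter_mem hi hr1
      obtain ⟨y, ⟨j, hj, rfl⟩, l, hl, he⟩ := Ultrafilter.nonempty_of_mem hint
      obtain ⟨N, hN⟩ := mem_some _ _ _ _ _ he
      refine hqf.finite_notMem ((Set.finite_Iic N).image fun j => t i * t j) ?_
      refine Filter.mem_of_superset hint ?_
      rintro y ⟨⟨j, hj, rfl⟩, l, hl, he⟩
      exact ⟨j, (key h N i j i l h1 hN he hj hl).2 rfl, rfl⟩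
    · refine ⟨{r | A ∈ r}, ultrafilter_isOpen_basic _, ?_⟩
      refine Set.Subset.antisymm ?_ (Set.singleton_subset_iff.2 ⟨hAq, hqc⟩)
      rintro r ⟨hr1, -, hr2⟩
      obtain ⟨h, rfl⟩ := horb r hr2
      by_cases h1 : h = 1
      · rw [h1, tr_one]; rfl
      exfalso
      have hr1 : {y | h * y ∈ A} ∈ q := hr1
      have hint := Filter.inter_mem hAq hr1
      obtain ⟨y, hy1, hy2⟩ := Ultrafilter.nonempty_of_mem hint
      obtain ⟨i, j, hij, rfl⟩ := Set.mem_iUnion.1 hy1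
      obtain ⟨k, l, hkl, he⟩ := Set.mem_iUnion.1 hy2
      obtain ⟨N, hN⟩ := mem_some _ _ _ _ _ he
      apply hB
      have : (⋃ i ∈ Set.Iic N, B i) ∈ q := by
        refine Filter.mem_of_superset hint ?_
        rintro y ⟨hy1, hy2⟩
        obtain ⟨i, j, hij, rfl⟩ := Set.mem_iUnion.1 hy1
        obtain ⟨k, l, hkl, he⟩ := Set.mem_iUnion.1 hy2
        exact Set.mem_iUnion₂.2 ⟨i, (key h N i j k l h1 hN he hij hkl).1, j, hij, rfl⟩
      obtain ⟨i, -, hi⟩ := (Ultrafilter.finite_biUnion_mem_iff (Set.finite_Iic N)).1 this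
      exact ⟨i, hi⟩
  · intro hsp
    let p : Ultrafilter G := (hyperfilter ℕ).map t
    have hpf : uFree p := by
      rw [uFree_iff]
      intro g
      change t ⁻¹' {x | x ≠ g} ∈ hyperfilter ℕ
      refine mem_hyperfilter_of_finite_compl ?_
      refine Set.Subsingleton.finite ?_
      intro m hm n hn
      simp only [Set.mem_compl_iff, Set.mem_preimage, Set.mem_setOf_eq, not_not] at hm hn
      exact htinj (hm.trans hn.symm)
    refine Set.infinite_of_injective_forall_mem ((tr_inj p).comp htinj) ?_ (hsp p hpf)
    intro i
    refine ⟨⟨?_, hpf.tr _⟩, t i, rfl⟩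
    change {j | t i * t j ∈ A} ∈ hyperfilter ℕ
    refine mem_hyperfilter_of_finite_compl ((Set.finite_Iic i).subset ?_)
    intro j hj
    by_contra hij
    exact hj (Set.mem_iUnion.2 ⟨i, j, not_le.1 hij, rfl⟩)

/-- Finite products with indices below `n`. -/
def words (y : ℕ → G) : ℕ → Set G
  | 0 => {1}
  | n + 1 => words y n ∪ {g | ∃ w ∈ words y n, g = w * y n}

theorem words_mono (y : ℕ → G) : Monotone (words y) :=
  monotone_nat_of_le_succ fun _ => Set.subset_union_left

theorem FP_words (y : ℕ → G) (s : Stream' G) (m : G) (hm : Hindman.FP s m) :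
    ∀ k, (∀ i, s.get i = y (k + i)) → ∀ u ∈ words y k,
      ∃ n, ∃ w ∈ words y n, u * m = w * y n := by
  induction hm with
  | head' a =>
    intro k hk u hu
    have hh : a.head = y k := hk 0
    exact ⟨k, u, hu, by rw [hh]⟩
  | tail' a m h ih =>
    intro k hk u hu
    refine ih (k + 1) (fun i => ?_) u (words_mono y (Nat.le_succ k) hu)
    have := hk (i + 1)
    rw [show k + 1 + i = k + (i + 1) by omega, ← this]
    rfl
  | cons' a m h ih =>
    intro k hk u hu
    have hh : a.head = y k := hk 0
    rw [hh, ← mul_assoc]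
    refine ih (k + 1) (fun i => ?_) (u * y k) (Or.inr ⟨u, hu, rfl⟩)
    have := hk (i + 1)
    rw [show k + 1 + i = k + (i + 1) by omega, ← this]
    rfl

theorem words_div (y : ℕ → G) (n : ℕ) : ∀ u ∈ words y n, ∀ v ∈ words y n,
    u * v⁻¹ = 1 ∨ ∃ m, ∃ a ∈ words y m, ∃ b ∈ words y m,
      u * v⁻¹ = a * y m * b⁻¹ ∨ u * v⁻¹ = a * (y m)⁻¹ * b⁻¹ := by
  induction n with
  | zero =>
    rintro u hu v hv
    left
    rw [Set.mem_singleton_iff.1 hu, Set.mem_singleton_iff.1 hv]; simp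
  | succ n ih =>
    rintro u (hu | ⟨u, hu, rfl⟩) v (hv | ⟨v, hv, rfl⟩)
    · exact ih u hu v hv
    · right
      exact ⟨n, u, hu, v, hv, Or.inr (by group)⟩
    · right
      exact ⟨n, u, hu, v, hv, Or.inl rfl⟩
    · have : u * y n * (v * y n)⁻¹ = u * v⁻¹ := by group
      rw [this]
      exact ih u hu v hv

theorem small_of_countable [Uncountable G] (A : Set G) (hA : A.Countable) : uSmall A := by
  refine small_crit A fun F hF => ?_
  have hc : (F * A).Countable := by
    rw [← Set.image2_mul]; exact hF.countable.image2 hA _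
  have hd : ((F * A) * (F * A)⁻¹).Countable := by
    rw [← Set.image2_mul, ← Set.image_inv_eq_inv]
    exact hc.image2 (hc.image _) _
  obtain ⟨z, hz⟩ : ∃ z, z ∉ (F * A) * (F * A)⁻¹ := by
    by_contra! h
    exact Set.not_countable_univ (hd.mono fun x _ => h x)
  refine ⟨{1, z}, by simp, fun x => ?_⟩
  by_contra! h
  have h1 := h 1 (by simp)
  have h2 := h z (by simp)
  apply hz
  refine ⟨z * x, h2, x⁻¹, ?_, by group⟩
  rw [one_mul] at h1
  exact Set.inv_mem_inv.2 h1

theorem exists_small_not_disparse [Infinite G] : ∃ A : Set G, uSmall A ∧ ¬uDisparse A := by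
  obtain ⟨e, he⟩ : ∃ e : ℕ → G, Countable G → Function.Surjective e := by
    by_cases h : Countable G
    · obtain ⟨e, he⟩ := exists_surjective_nat G
      exact ⟨e, fun _ => he⟩
    · exact ⟨fun _ => 1, fun h' => (h h').elim⟩
  obtain ⟨F, x, hfin, heF, hx1, hx2, hmono, hinv, hmul⟩ := exists_chain e
  have mul' : ∀ {a b c : ℕ} {g h : G}, g ∈ F a → h ∈ F b → a < c → b < c → g * h ∈ F c := by
    intro a b c g h hg hh hac hbc
    have := hmul (c - 1) g (hmono (by omega) hg) h (hmono (by omega) hh)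
    rwa [Nat.sub_add_cancel (by omega)] at this
  have mul6 : ∀ (n : ℕ) {a b c d e f : G}, a ∈ F n → b ∈ F n → c ∈ F n → d ∈ F n → e ∈ F n →
      f ∈ F n → a * (b * (c * (d * (e * f)))) ∈ F (n + 5) := by
    intro n a b c d e f ha hb hc hd he hf
    have h1 : e * f ∈ F (n + 1) := hmul _ _ he _ hf
    have h2 : d * (e * f) ∈ F (n + 2) := mul' hd h1 (by omega) (by omega)
    have h3 : c * (d * (e * f)) ∈ F (n + 3) := mul' hc h2 (by omega) (by omega)
    have h4 : b * (c * (d * (e * f))) ∈ F (n + 4) := mul' hb h3 (by omega) (by omega)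
    exact mul' ha h4 (by omega) (by omega)
  have hone : (1 : G) ∈ F 2 := by
    have := hmul 1 _ (heF 0) _ (hinv _ _ (heF 0))
    rwa [mul_inv_cancel] at this
  let y : ℕ → G := fun n => x (20 * n + 10)
  let z : ℕ → G := fun n => x (20 * n + 4)
  have hy1 : ∀ n, y n ∉ F (20 * n + 10) := fun n => hx1 _
  have hy2 : ∀ n, y n ∈ F (20 * n + 11) := fun n => hx2 _
  have hz1 : ∀ n, z n ∉ F (20 * n + 4) := fun n => hx1 _
  have hz2 : ∀ n, z n ∈ F (20 * n + 5) := fun n => hx2 _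
  have hW : ∀ n, words y n ⊆ F (20 * n + 2) := by
    intro n
    induction n with
    | zero =>
      intro g hg
      rw [Set.mem_singleton_iff.1 hg]; exact hone
    | succ n ih =>
      rintro g (hg | ⟨w, hw, rfl⟩)
      · exact hmono (by omega) (ih hg)
      · exact mul' (ih hw) (hy2 n) (by omega) (by omega)
  let A : Set G := ⋃ n, {g | ∃ w ∈ words y n, g = w * y n}
  have h1A : (1 : G) ∉ A := by
    intro h
    obtain ⟨n, w, hw, h⟩ := Set.mem_iUnion.1 h
    apply hy1 n
    have : y n = w⁻¹ := (inv_eq_of_mul_eq_one_right h.symm).symm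
    rw [this]
    exact hmono (by omega) (hinv _ _ (hW n hw))
  have hAw : ∀ g ∈ A, ∃ n, g ∈ words y n := by
    intro g h
    obtain ⟨n, h⟩ := Set.mem_iUnion.1 h
    exact ⟨n + 1, Or.inr h⟩
  refine ⟨A, ?_, ?_⟩
  · by_cases hG : Countable G
    · refine small_crit A fun E hE => ?_
      have hex : ∀ g : G, ∃ n, g ∈ F n := by
        intro g
        obtain ⟨n, rfl⟩ := he hG g
        exact ⟨n + 1, heF n⟩
      obtain ⟨N, hN⟩ : ∃ N, E ⊆ F N := by
        choose r hr using hex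
        obtain ⟨N, hN⟩ := (hE.image r).bddAbove
        exact ⟨N, fun g hg => hmono (hN ⟨g, hg, rfl⟩) (hr g)⟩
      have key : ∀ j j', N ≤ j → j < j' → ∀ f ∈ E, ∀ s, f⁻¹ * z j * s ∈ A → f⁻¹ * z j' * s ∈ A →
          False := by
        intro j j' hj hjj f hf s hs hs'
        have hfN : f ∈ F (20 * j') := hmono (by omega) (hN hf)
        have hfN' : f ∈ F (20 * j' - 8) := hmono (by omega) (hN hf)
        have hzj : z j ∈ F (20 * j' - 8) := hmono (by omega) (hz2 j)
        obtain ⟨n, hn⟩ := hAw _ hs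
        obtain ⟨n', hn'⟩ := hAw _ hs'
        have hd : (f⁻¹ * z j' * s) * (f⁻¹ * z j * s)⁻¹ = f⁻¹ * z j' * (z j)⁻¹ * f := by group
        have hwd := words_div y (n + n') _ (words_mono y (by omega) hn') _
          (words_mono y (by omega) hn)
        rw [hd] at hwd
        rcases hwd with h | ⟨m, a, ha, b, hb, h⟩
        · have : z j' = z j := by
            have h2 : z j' = f * (f⁻¹ * z j' * (z j)⁻¹ * f) * f⁻¹ * z j := by group
            rw [h] at h2; simpa using h2
          apply hz1 j'
          rw [this]
          exact hmono (by omega) hzj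
        · have h' : ∃ v, (v = y m ∨ v = (y m)⁻¹) ∧
              f⁻¹ * z j' * (z j)⁻¹ * f = a * v * b⁻¹ := by
            rcases h with h | h
            · exact ⟨_, Or.inl rfl, h⟩
            · exact ⟨_, Or.inr rfl, h⟩
          obtain ⟨v, hv, h⟩ := h'
          have ha := hW m ha
          have hb := hW m hb
          by_cases hm : m < j'
          · have hv' : v ∈ F (20 * j' - 8) := by
              rcases hv with rfl | rfl
              · exact hmono (by omega) (hy2 m)
              · exact hinv _ _ (hmono (by omega) (hy2 m))
            have e1 : z j' = f * (a * (v * (b⁻¹ * (f⁻¹ * z j)))) := by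
              have h2 : z j' = f * (f⁻¹ * z j' * (z j)⁻¹ * f) * f⁻¹ * z j := by group
              rw [h] at h2; rw [h2]; group
            apply hz1 j'
            rw [e1]
            refine hmono ?_ (mul6 (20 * j' - 8) hfN' (hmono (by omega) ha) hv'
              (hinv _ _ (hmono (by omega) hb)) (hinv _ _ hfN') hzj)
            omega
          · have e1 : v = a⁻¹ * (f⁻¹ * (z j' * ((z j)⁻¹ * (f * b)))) := by
              have h2 : v = a⁻¹ * (a * v * b⁻¹) * b := by group
              rw [← h] at h2; rw [h2]; group
            have hv' : v ∈ F (20 * m + 10) := by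
              rw [e1]
              have hf' : f ∈ F (20 * m + 5) := hmono (by omega) hfN
              exact mul6 (20 * m + 5) (hinv _ _ (hmono (by omega) ha)) (hinv _ _ hf')
                (hmono (by omega) (hz2 j')) (hinv _ _ (hmono (by omega) hzj)) hf'
                (hmono (by omega) hb)
            apply hy1 m
            rcases hv with rfl | rfl
            · exact hv'
            · simpa using hinv _ _ hv'
      let n := hE.toFinset.card
      refine ⟨z '' Set.Icc N (N + n), (Set.finite_Icc _ _).image _, fun s => ?_⟩
      by_contra! hcon
      have hch : ∀ j ∈ Finset.Icc N (N + n), ∃ f ∈ hE.toFinset, f⁻¹ * z j * s ∈ A := by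
        intro j hj
        obtain ⟨f, hf, a, ha, hfa⟩ := hcon (z j) ⟨j, by simpa using hj, rfl⟩
        refine ⟨f, by simpa using hf, ?_⟩
        have hfa : f * a = z j * s := hfa
        rw [mul_assoc, ← hfa]
        simpa using ha
      choose! φ hφ1 hφ2 using hch
      obtain ⟨j, hj, j', hj', hne, heq⟩ := Finset.exists_ne_map_eq_of_card_lt_of_maps_to
        (s := Finset.Icc N (N + n)) (t := hE.toFinset) (by simp [n]; omega) hφ1
      have hm := hφ2 j hj
      have hm' := hφ2 j' hj'
      have hfE : φ j ∈ E := by simpa using hφ1 j hj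
      rw [Finset.mem_Icc] at hj hj'
      rw [← heq] at hm'
      rcases lt_or_gt_of_ne hne with h | h
      · exact key j j' hj.1 h _ hfE s hm hm'
      · exact key j' j hj'.1 h _ hfE s hm' hm
    · have : Uncountable G := not_countable_iff.1 hG
      refine small_of_countable A ?_
      have hsub : A ⊆ ⋃ n, F n := by
        intro g hg
        obtain ⟨n, hn⟩ := hAw g hg
        exact Set.mem_iUnion.2 ⟨_, hW n hn⟩
      exact (Set.countable_iUnion fun n => (hfin n).countable).mono hsub
  · intro hdis
    letI := (Ultrafilter.semigroup : Semigroup (Ultrafilter G))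
    obtain ⟨p, hpp, hpFP⟩ := Hindman.exists_idempotent_ultrafilter_le_FP (M := G) (y : Stream' G)
    have hAp : A ∈ p := by
      refine Filter.mem_of_superset hpFP ?_
      intro g hg
      obtain ⟨n, w, hw, h⟩ := FP_words y y g hg 0 (fun i => by rw [Nat.zero_add]; rfl) 1 rfl
      rw [one_mul] at h
      exact Set.mem_iUnion.2 ⟨n, w, hw, h⟩
    have hidem : ∀ P : Set G, P ∈ p → {g | P ∈ uMul (pure g) p} ∈ p := by
      intro P hP
      have h1 : ∀ᶠ m in (p * p : Ultrafilter G), m ∈ P := by rw [hpp]; exact hP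
      exact (Ultrafilter.eventually_mul p p (· ∈ P)).1 h1
    have hpf : uFree p := by
      intro g hg
      have h1 : ({g} : Set G) ∈ p := by rw [hg]; exact Ultrafilter.mem_pure.2 rfl
      have h2 := hidem _ h1
      rw [hg, Ultrafilter.mem_pure] at h2
      have h3 : g * g = g := h2
      have h4 : g = 1 := mul_eq_left.1 h3
      rw [hg, Ultrafilter.mem_pure, h4] at hAp
      exact h1A hAp
    obtain ⟨U, hUo, hU⟩ := discreteTopology_subtype_iff'.1 (hdis p hpf) p
      ⟨⟨hAp, hpf⟩, 1, (tr_one p).symm⟩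
    have hpU : p ∈ U := by
      have : p ∈ U ∩ uCompanion A p := hU ▸ rfl
      exact this.1
    obtain ⟨_, ⟨P, rfl⟩, hP, hPU⟩ := ultrafilterBasis_is_basis.exists_subset_of_mem_open hpU hUo
    obtain ⟨g, ⟨hg1, hg2⟩, hg3⟩ := Ultrafilter.nonempty_of_mem
      (Filter.inter_mem (Filter.inter_mem (hidem P hP) (hidem A hAp)) (uFree_iff.1 hpf 1))
    have : uMul (pure g) p ∈ U ∩ uCompanion A p := ⟨hPU hg1, ⟨hg2, hpf.tr g⟩, g, rfl⟩
    rw [hU] at this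
    exact tr_ne hg3 p this

end helpers

/-- Proposition 12: `Sp_G ⊂ dSp_G ⊂ Sm_G`, and both inclusions are strict. -/
theorem statement17 {G : Type*} [Group G] [Infinite G] :
    (∀ A : Set G, uSparse A → uDisparse A)
    ∧ (∀ A : Set G, uDisparse A → uSmall A)
    ∧ (∃ A : Set G, uDisparse A ∧ ¬uSparse A)
    ∧ (∃ A : Set G, uSmall A ∧ ¬uDisparse A) := by
  exact ⟨sparse_disparse, disparse_small, exists_disparse_not_sparse,
    exists_small_not_disparse⟩
end
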